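/- Assume f satisfies condition (OSC). There exist constants Λ₃, Λ₄ > 0, depending only on n, Ω, Ω̃ and f, such that every strictly convex solution u of the second boundary value problem with data (f, c) satisfies, for all x ∈ Ω, Λ₃ ≤ trace(A(x)²) ≤ Λ₄; here trace(A(x)²) equals the sum of the squares κ₁² + ⋯ + κₙ² of the principal curvatures of the graph of u at (x, u(x)) in Minkowski space. -/

import Mathlib

open Set MeasureTheory Matrix
open scoped Topology RealInnerProductSpace NNReal

noncomputable section

abbrev Euc (n : ℕ) := EuclideanSpace ℝ (Fin n)

variable {n : ℕ}

/-- Hessian matrix of `u` at `x`. -/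
def Hess (u : Euc n → ℝ) (x : Euc n) : Matrix (Fin n) (Fin n) ℝ :=
  fun i j => iteratedFDeriv ℝ 2 u x ![EuclideanSpace.single i 1, EuclideanSpace.single j 1]

/-- `A ≤ B` in the sense of symmetric matrices. -/
def MatLE (A B : Matrix (Fin n) (Fin n) ℝ) : Prop := (B - A).PosSemidef

/-- The Minkowski mean-curvature operator `div (∇u / √(1 - |∇u|²))`. -/
def MinkDiv (u : Euc n → ℝ) (x : Euc n) : ℝ :=
  ∑ i, fderiv ℝ (fun y => (Real.sqrt (1 - ‖gradient u y‖ ^ 2))⁻¹ * gradient u y i) x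
    (EuclideanSpace.single i 1)

/-- The Euclidean mean-curvature operator `div (∇u / √(1 + |∇u|²))`. -/
def EucDiv (u : Euc n → ℝ) (x : Euc n) : ℝ :=
  ∑ i, fderiv ℝ (fun y => (Real.sqrt (1 + ‖gradient u y‖ ^ 2))⁻¹ * gradient u y i) x
    (EuclideanSpace.single i 1)

/-- `S(p) = (1/v)(Iₙ + p pᵀ / v²)`, `v = √(1-|p|²)`. -/
def Smat (p : Euc n) : Matrix (Fin n) (Fin n) ℝ :=
  (Real.sqrt (1 - ‖p‖ ^ 2))⁻¹ •
    ((1 : Matrix (Fin n) (Fin n) ℝ) +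
      (1 - ‖p‖ ^ 2)⁻¹ • Matrix.vecMulVec (fun i => p i) (fun j => p j))

/-- `B(p) = Iₙ + p pᵀ / (v (1 + v))`, `v = √(1-|p|²)`. -/
def Bmat (p : Euc n) : Matrix (Fin n) (Fin n) ℝ :=
  (1 : Matrix (Fin n) (Fin n) ℝ) +
    (Real.sqrt (1 - ‖p‖ ^ 2) * (1 + Real.sqrt (1 - ‖p‖ ^ 2)))⁻¹ •
      Matrix.vecMulVec (fun i => p i) (fun j => p j)

/-- `A(x) = (1/v)·B(∇u)·D²u·B(∇u)`: its eigenvalues are the principal curvatures. -/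
def Amat (u : Euc n → ℝ) (x : Euc n) : Matrix (Fin n) (Fin n) ℝ :=
  (Real.sqrt (1 - ‖gradient u x‖ ^ 2))⁻¹ •
    (Bmat (gradient u x) * Hess u x * Bmat (gradient u x))

/-- supremum of the quadratic form of `A` over the unit sphere (the operator
norm / largest eigenvalue for a positive semidefinite symmetric `A`). -/
def quadSup (A : Matrix (Fin n) (Fin n) ℝ) : ℝ :=
  ⨆ ξ : Metric.sphere (0 : Euc n) 1,
    (fun i => (ξ : Euc n) i) ⬝ᵥ A.mulVec (fun i => (ξ : Euc n) i)

/-- The domains `Ω = {h̃ > 0}`, `Ω̃ = {h > 0}` are bounded uniformly convex domains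
with smooth boundary, described by the defining functions `h̃` and `h`. -/
def DomainSetup (Ω Ωt : Set (Euc n)) (ht h : Euc n → ℝ) (θt θ : ℝ) : Prop :=
  IsOpen Ω ∧ IsOpen Ωt ∧ Bornology.IsBounded Ω ∧ Bornology.IsBounded Ωt ∧
  Ω.Nonempty ∧ Ωt.Nonempty ∧
  ContDiff ℝ (⊤ : ℕ∞) ht ∧ ContDiff ℝ (⊤ : ℕ∞) h ∧
  Ω = {x | 0 < ht x} ∧ Ωt = {y | 0 < h y} ∧
  (∀ x ∈ frontier Ω, ‖gradient ht x‖ = 1) ∧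
  (∀ y ∈ frontier Ωt, ‖gradient h y‖ = 1) ∧
  0 < θt ∧ 0 < θ ∧
  (∀ x : Euc n, MatLE (Hess ht x) ((-θt) • (1 : Matrix (Fin n) (Fin n) ℝ))) ∧
  (∀ y : Euc n, MatLE (Hess h y) ((-θ) • (1 : Matrix (Fin n) (Fin n) ℝ)))

/-- `f ∈ 𝒜`: `f` is `C²` on `Ω̄ × closure Ω̃` and concave in `x`. -/
def InA (Ω Ωt : Set (Euc n)) (f : Euc n × Euc n → ℝ) : Prop :=
  ContDiffOn ℝ 2 f (closure Ω ×ˢ closure Ωt) ∧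
  ∀ p ∈ closure Ωt, ConcaveOn ℝ (closure Ω) (fun x => f (x, p))

/-- Condition (OSC): `osc f ≤ (n/2)(|Ω̃|/|Ω|)^{1/n}`. -/
def OSCcond (Ω Ωt : Set (Euc n)) (f : Euc n × Euc n → ℝ) : Prop :=
  ∀ x ∈ closure Ω, ∀ y ∈ closure Ω, ∀ p ∈ closure Ωt, ∀ q ∈ closure Ωt,
    |f (x, p) - f (y, q)| ≤
      ((n : ℝ) / 2) * ((volume Ωt).toReal / (volume Ω).toReal) ^ ((1 : ℝ) / n)

/-- `‖f‖_{C²(Ω̄ × closure Ω̃)} ≤ K`. -/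
def C2Bound (Ω Ωt : Set (Euc n)) (f : Euc n × Euc n → ℝ) (K : ℝ) : Prop :=
  ContDiffOn ℝ 2 f (closure Ω ×ˢ closure Ωt) ∧
  ∀ z ∈ closure Ω ×ˢ closure Ωt,
    |f z| ≤ K ∧ ‖fderiv ℝ f z‖ ≤ K ∧ ‖iteratedFDeriv ℝ 2 f z‖ ≤ K

/-- `sup |D_x f| ≤ ε` on `Ω̄ × closure Ω̃`. -/
def DxBound (Ω Ωt : Set (Euc n)) (f : Euc n × Euc n → ℝ) (ε : ℝ) : Prop :=
  ∀ x ∈ closure Ω, ∀ p ∈ closure Ωt, ‖fderiv ℝ (fun x' => f (x', p)) x‖ ≤ ε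

/-- `sup |D_{xp} f| ≤ ε` on `Ω̄ × closure Ω̃`. -/
def DxpBound (Ω Ωt : Set (Euc n)) (f : Euc n × Euc n → ℝ) (ε : ℝ) : Prop :=
  ∀ x ∈ closure Ω, ∀ p ∈ closure Ωt,
    ‖fderiv ℝ (fun p' => fderiv ℝ (fun x' => f (x', p')) x) p‖ ≤ ε

/-- A strictly convex solution of the second boundary value problem. -/
def IsStrictSol (Ω Ωt : Set (Euc n)) (f : Euc n × Euc n → ℝ) (c : ℝ) (u : Euc n → ℝ) : Prop :=
  ContDiffOn ℝ 2 u (closure Ω) ∧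
  (∀ x ∈ closure Ω, (Hess u x).PosDef) ∧
  (∀ x ∈ closure Ω, ‖gradient u x‖ < 1) ∧
  (∀ x ∈ Ω, MinkDiv u x = f (x, gradient u x) + c) ∧
  gradient u '' Ω = Ωt

/-- A smooth uniformly convex solution of the second boundary value problem. -/
def IsSmoothSol (Ω Ωt : Set (Euc n)) (f : Euc n × Euc n → ℝ) (c : ℝ) (u : Euc n → ℝ) : Prop :=
  ContDiffOn ℝ (⊤ : ℕ∞) u (closure Ω) ∧
  (∃ δ : ℝ, 0 < δ ∧ ∀ x ∈ closure Ω, MatLE (δ • (1 : Matrix (Fin n) (Fin n) ℝ)) (Hess u x)) ∧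
  (∀ x ∈ closure Ω, ‖gradient u x‖ < 1) ∧
  (∀ x ∈ Ω, MinkDiv u x = f (x, gradient u x) + c) ∧
  gradient u '' Ω = Ωt

/-- A uniformly convex `C^{2}` solution of the second boundary value problem. -/
def IsUCSol (Ω Ωt : Set (Euc n)) (f : Euc n × Euc n → ℝ) (c : ℝ) (u : Euc n → ℝ) : Prop :=
  ContDiffOn ℝ 2 u (closure Ω) ∧
  (∃ δ : ℝ, 0 < δ ∧ ∀ x ∈ closure Ω, MatLE (δ • (1 : Matrix (Fin n) (Fin n) ℝ)) (Hess u x)) ∧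
  (∀ x ∈ closure Ω, ‖gradient u x‖ < 1) ∧
  (∀ x ∈ Ω, MinkDiv u x = f (x, gradient u x) + c) ∧
  gradient u '' Ω = Ωt

/-- A uniformly convex `C^{4,α}` solution of the second boundary value problem
for the Minkowski mean-curvature operator. -/
def IsC4Sol (Ω Ωt : Set (Euc n)) (f : Euc n × Euc n → ℝ) (c : ℝ) (u : Euc n → ℝ)
    (α : ℝ) : Prop :=
  ContDiffOn ℝ 4 u (closure Ω) ∧
  (∃ C : ℝ≥0, HolderOnWith C (Real.toNNReal α) (fun x => iteratedFDeriv ℝ 4 u x) (closure Ω)) ∧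
  (∃ δ : ℝ, 0 < δ ∧ ∀ x ∈ closure Ω, MatLE (δ • (1 : Matrix (Fin n) (Fin n) ℝ)) (Hess u x)) ∧
  (∀ x ∈ closure Ω, ‖gradient u x‖ < 1) ∧
  (∀ x ∈ Ω, MinkDiv u x = f (x, gradient u x) + c) ∧
  gradient u '' Ω = Ωt

/-- A uniformly convex `C^{4,α}` solution of the second boundary value problem
for the Euclidean mean-curvature operator. -/
def IsC4SolE (Ω Ωt : Set (Euc n)) (f : Euc n × Euc n → ℝ) (c : ℝ) (u : Euc n → ℝ)
    (α : ℝ) : Prop :=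
  ContDiffOn ℝ 4 u (closure Ω) ∧
  (∃ C : ℝ≥0, HolderOnWith C (Real.toNNReal α) (fun x => iteratedFDeriv ℝ 4 u x) (closure Ω)) ∧
  (∃ δ : ℝ, 0 < δ ∧ ∀ x ∈ closure Ω, MatLE (δ • (1 : Matrix (Fin n) (Fin n) ℝ)) (Hess u x)) ∧
  (∀ x ∈ Ω, EucDiv u x = f (x, gradient u x) + c) ∧
  gradient u '' Ω = Ωt

/-- `ũ` is the Legendre transform of `u`. -/
def IsLegendre (Ω Ωt : Set (Euc n)) (u ut : Euc n → ℝ) : Prop :=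
  ContDiffOn ℝ (⊤ : ℕ∞) ut (closure Ωt) ∧
  (∀ x ∈ closure Ω, ut (gradient u x) = ⟪x, gradient u x⟫ - u x) ∧
  (∀ x ∈ closure Ω, gradient ut (gradient u x) = x) ∧
  (∀ x ∈ closure Ω, Hess ut (gradient u x) = (Hess u x)⁻¹)

/-- A symmetric positive semidefinite matrix has `A i j ^ 2 ≤ A i i * A j j`. -/
lemma posSemidef_sq_apply_le {A : Matrix (Fin n) (Fin n) ℝ} (hA : A.PosSemidef) (i j : Fin n) :
    A i j ^ 2 ≤ A i i * A j j := by
  have hd := (hA.submatrix ![i, j]).det_nonneg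
  have hs : A j i = A i j := by simpa using hA.isHermitian.apply i j
  rw [Matrix.det_fin_two] at hd
  simp only [Matrix.submatrix_apply, Matrix.cons_val_zero, Matrix.cons_val_one, hs] at hd
  nlinarith

lemma trace_sq_eq_sum {A : Matrix (Fin n) (Fin n) ℝ} (hA : A.IsHermitian) :
    (A ^ 2).trace = ∑ i, ∑ j, A i j ^ 2 := by
  simp only [pow_two A, Matrix.trace, Matrix.diag, Matrix.mul_apply]
  refine Finset.sum_congr rfl fun i _ => Finset.sum_congr rfl fun j _ => ?_
  have hs : A j i = A i j := by simpa using hA.apply i j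
  rw [hs, pow_two]

lemma trace_sq_le {A : Matrix (Fin n) (Fin n) ℝ} (hA : A.PosSemidef) :
    (A ^ 2).trace ≤ A.trace ^ 2 := by
  rw [trace_sq_eq_sum hA.isHermitian, pow_two A.trace, Matrix.trace, Finset.sum_mul_sum]
  exact Finset.sum_le_sum fun i _ => Finset.sum_le_sum fun j _ => posSemidef_sq_apply_le hA i j

lemma sq_trace_le {A : Matrix (Fin n) (Fin n) ℝ} (hA : A.IsHermitian) :
    A.trace ^ 2 ≤ n * (A ^ 2).trace := by
  rw [trace_sq_eq_sum hA, Matrix.trace]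
  have h1 := sq_sum_le_card_mul_sum_sq (s := Finset.univ) (f := A.diag)
  rw [Finset.card_univ, Fintype.card_fin] at h1
  refine h1.trans ?_
  gcongr with i
  exact Finset.single_le_sum (f := fun j => A i j ^ 2) (fun j _ => sq_nonneg _) (Finset.mem_univ i)

lemma det_le_trace_div_pow (hn : n ≠ 0) {A : Matrix (Fin n) (Fin n) ℝ} (hA : A.PosSemidef) :
    A.det ≤ (A.trace / n) ^ n := by
  have hn' : (0 : ℝ) < n := by positivity
  have hnn : ∀ i, 0 ≤ hA.isHermitian.eigenvalues i := hA.eigenvalues_nonneg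
  have hdet : A.det = ∏ i, hA.isHermitian.eigenvalues i := by
    simpa using hA.isHermitian.det_eq_prod_eigenvalues
  have htr : A.trace = ∑ i, hA.isHermitian.eigenvalues i := by
    simpa using hA.isHermitian.trace_eq_sum_eigenvalues
  have h := Real.geom_mean_le_arith_mean Finset.univ (fun _ => 1) hA.isHermitian.eigenvalues
    (fun _ _ => zero_le_one) (by simpa using Nat.pos_of_ne_zero hn) (fun i _ => hnn i)
  simp only [Real.rpow_one, one_mul, Finset.sum_const, Finset.card_univ, Fintype.card_fin,
    nsmul_eq_mul, mul_one, ← hdet, ← htr] at h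
  calc A.det = (A.det ^ (n : ℝ)⁻¹) ^ n := (Real.rpow_inv_natCast_pow hA.det_nonneg hn).symm
    _ ≤ (A.trace / n) ^ n := by
      have := Real.rpow_nonneg hA.det_nonneg (n : ℝ)⁻¹
      gcongr

lemma differentiableAt_gradient {u : Euc n → ℝ} {x : Euc n} (hu : ContDiffAt ℝ 2 u x) :
    DifferentiableAt ℝ (gradient u) x := by
  have h1 : DifferentiableAt ℝ (fderiv ℝ u) x :=
    (hu.fderiv_right (m := 1) (by norm_num)).differentiableAt (by norm_num)
  exact (InnerProductSpace.toDual ℝ (Euc n)).symm.toContinuousLinearEquiv.differentiableAt.comp x h1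

lemma inner_fderiv_gradient {u : Euc n → ℝ} {x : Euc n} (hu : ContDiffAt ℝ 2 u x) (a b : Euc n) :
    ⟪fderiv ℝ (gradient u) x a, b⟫ = fderiv ℝ (fderiv ℝ u) x a b := by
  have h1 : DifferentiableAt ℝ (fderiv ℝ u) x :=
    (hu.fderiv_right (m := 1) (by norm_num)).differentiableAt (by norm_num)
  have h2 : HasFDerivAt (gradient u) _ x :=
    (InnerProductSpace.toDual ℝ (Euc n)).symm.toContinuousLinearEquiv.hasFDerivAt.comp x
      h1.hasFDerivAt
  rw [h2.fderiv]
  exact InnerProductSpace.toDual_symm_apply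

lemma hess_apply (u : Euc n → ℝ) (x : Euc n) (i j : Fin n) :
    Hess u x i j =
      fderiv ℝ (fderiv ℝ u) x (EuclideanSpace.single i 1) (EuclideanSpace.single j 1) := by
  simp [Hess, iteratedFDeriv_two_apply]

lemma fderiv_gradient_single_apply {u : Euc n → ℝ} {x : Euc n} (hu : ContDiffAt ℝ 2 u x)
    (i j : Fin n) :
    fderiv ℝ (gradient u) x (EuclideanSpace.single i 1) j = Hess u x i j := by
  rw [hess_apply, ← inner_fderiv_gradient hu, EuclideanSpace.inner_single_right]
  simp

lemma det_fderiv_gradient {u : Euc n → ℝ} {x : Euc n} (hu : ContDiffAt ℝ 2 u x) :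
    (fderiv ℝ (gradient u) x).det = (Hess u x).det := by
  rw [ContinuousLinearMap.det, ← LinearMap.det_toMatrix (EuclideanSpace.basisFun (Fin n) ℝ).toBasis,
    ← Matrix.det_transpose]
  congr 1
  ext i j
  simp [LinearMap.toMatrix_apply, ← fderiv_gradient_single_apply hu]

lemma euc_eq_sum_single (ξ : Euc n) : ξ = ∑ i, ξ i • EuclideanSpace.single i (1 : ℝ) := by
  simpa using ((EuclideanSpace.basisFun (Fin n) ℝ).sum_repr ξ).symm

lemma fderiv_fderiv_apply (u : Euc n → ℝ) (x a b : Euc n) :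
    fderiv ℝ (fderiv ℝ u) x a b = ∑ i, ∑ j, a i * b j * Hess u x i j := by
  conv_lhs => rw [euc_eq_sum_single a, euc_eq_sum_single b]
  simp only [map_sum, map_smul, _root_.sum_apply, _root_.smul_apply,
    smul_eq_mul, hess_apply, Finset.mul_sum]
  rw [Finset.sum_comm]
  refine Finset.sum_congr rfl fun i _ => Finset.sum_congr rfl fun j _ => ?_
  ring

/-- Non-divergence form of the Minkowski mean-curvature operator. -/
lemma minkDiv_eq {u : Euc n → ℝ} {x : Euc n} (hu : ContDiffAt ℝ 2 u x)
    (hg : ‖gradient u x‖ < 1) :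
    MinkDiv u x = (√(1 - ‖gradient u x‖ ^ 2))⁻¹ * ((Hess u x).trace +
      (1 - ‖gradient u x‖ ^ 2)⁻¹ *
        fderiv ℝ (fderiv ℝ u) x (gradient u x) (gradient u x)) := by
  have hd := (differentiableAt_gradient hu).hasFDerivAt
  have hw : 0 < 1 - ‖gradient u x‖ ^ 2 := by nlinarith [norm_nonneg (gradient u x)]
  have hv : 0 < √(1 - ‖gradient u x‖ ^ 2) := Real.sqrt_pos.2 hw
  have hvv : √(1 - ‖gradient u x‖ ^ 2) ^ 2 = 1 - ‖gradient u x‖ ^ 2 := Real.sq_sqrt hw.le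
  have key : ∀ i : Fin n,
      fderiv ℝ (fun y => (√(1 - ‖gradient u y‖ ^ 2))⁻¹ * gradient u y i) x
        (EuclideanSpace.single i 1) =
      (√(1 - ‖gradient u x‖ ^ 2))⁻¹ * (Hess u x i i +
        (1 - ‖gradient u x‖ ^ 2)⁻¹ * (gradient u x i *
          fderiv ℝ (fderiv ℝ u) x (EuclideanSpace.single i 1) (gradient u x))) := by
    intro i
    have h1 := (hasDerivAt_inv hv.ne').comp_hasFDerivAt x ((hd.norm_sq.const_sub 1).sqrt hw.ne')
    have h2 := (EuclideanSpace.proj (𝕜 := ℝ) i).hasFDerivAt.comp x hd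
    have h3 := h1.mul h2
    have h4 : fderiv ℝ (fun y => (√(1 - ‖gradient u y‖ ^ 2))⁻¹ * gradient u y i) x = _ := h3.fderiv
    rw [h4]
    have e1 := fderiv_gradient_single_apply hu i i
    have e2 := inner_fderiv_gradient hu (EuclideanSpace.single i 1) (gradient u x)
    rw [real_inner_comm] at e2
    simp [e1, e2]
    rw [hvv]
    field_simp
  have hsum : fderiv ℝ (fderiv ℝ u) x (gradient u x) (gradient u x) = ∑ i, gradient u x i *
      fderiv ℝ (fderiv ℝ u) x (EuclideanSpace.single i 1) (gradient u x) := by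
    conv_lhs => arg 1; rw [euc_eq_sum_single (gradient u x)]
    simp
  rw [MinkDiv, hsum, Finset.sum_congr rfl fun i _ => key i, ← Finset.mul_sum,
    Finset.sum_add_distrib, ← Finset.mul_sum]
  rfl

lemma vecMulVec_mul_self (p : Euc n) :
    Matrix.vecMulVec (fun i => p i) (fun j => p j) * Matrix.vecMulVec (fun i => p i) (fun j => p j) =
      ‖p‖ ^ 2 • Matrix.vecMulVec (fun i => p i) (fun j => p j) := by
  ext i j
  simp only [Matrix.mul_apply, Matrix.vecMulVec_apply, Matrix.smul_apply, smul_eq_mul,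
    EuclideanSpace.norm_sq_eq, Real.norm_eq_abs, sq_abs, Finset.sum_mul]
  exact Finset.sum_congr rfl fun k _ => by ring

lemma bmat_mul_self {p : Euc n} (hp : ‖p‖ < 1) :
    Bmat p * Bmat p = 1 + (1 - ‖p‖ ^ 2)⁻¹ • Matrix.vecMulVec (fun i => p i) (fun j => p j) := by
  have hw : 0 < 1 - ‖p‖ ^ 2 := by nlinarith [norm_nonneg p]
  have hv : 0 < √(1 - ‖p‖ ^ 2) := Real.sqrt_pos.2 hw
  have hvv : √(1 - ‖p‖ ^ 2) ^ 2 = 1 - ‖p‖ ^ 2 := Real.sq_sqrt hw.le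
  have hpp : ‖p‖ ^ 2 = 1 - √(1 - ‖p‖ ^ 2) ^ 2 := by rw [hvv]; ring
  have expand : ∀ a : ℝ, ∀ M : Matrix (Fin n) (Fin n) ℝ, M * M = ‖p‖ ^ 2 • M →
      (1 + a • M) * (1 + a • M) = 1 + (2 * a + a ^ 2 * ‖p‖ ^ 2) • M := by
    intro a M hM
    rw [add_mul, mul_add, mul_add, one_mul, mul_one, one_mul, smul_mul_smul_comm, hM]
    module
  rw [Bmat, expand _ _ (vecMulVec_mul_self p)]
  congr 2
  have hinv : (1 - ‖p‖ ^ 2)⁻¹ = (√(1 - ‖p‖ ^ 2) ^ 2)⁻¹ := by rw [hvv]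
  rw [hinv]
  generalize √(1 - ‖p‖ ^ 2) = v at hv hpp ⊢
  rw [hpp]
  field_simp
  ring

lemma bmat_isHermitian (p : Euc n) : (Bmat p).IsHermitian := by
  ext i j
  simp [Bmat, Matrix.vecMulVec_apply, Matrix.one_apply, eq_comm, mul_comm]

lemma one_le_det_bmat (p : Euc n) : 1 ≤ (Bmat p).det := by
  rw [Bmat, ← Matrix.smul_vecMulVec, Matrix.vecMulVec_eq Unit,
    Matrix.det_one_add_replicateCol_mul_replicateRow, dotProduct_smul, smul_eq_mul]
  have h1 : 0 ≤ (fun j => p j) ⬝ᵥ (fun j => p j) :=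
    Finset.sum_nonneg fun i _ => mul_self_nonneg _
  have := Real.sqrt_nonneg (1 - ‖p‖ ^ 2)
  linarith [mul_nonneg (inv_nonneg.2 (mul_nonneg this (add_nonneg zero_le_one this))) h1]

lemma amat_posSemidef {u : Euc n → ℝ} {x : Euc n} (hH : (Hess u x).PosSemidef) :
    (Amat u x).PosSemidef := by
  have h := hH.mul_mul_conjTranspose_same (Bmat (gradient u x))
  rw [(bmat_isHermitian _).eq] at h
  exact h.smul (inv_nonneg.2 (Real.sqrt_nonneg _))

/-- The trace of the curvature matrix is the mean curvature. -/
lemma trace_amat {u : Euc n → ℝ} {x : Euc n} (hu : ContDiffAt ℝ 2 u x)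
    (hg : ‖gradient u x‖ < 1) : (Amat u x).trace = MinkDiv u x := by
  rw [minkDiv_eq hu hg, Amat, Matrix.trace_smul, smul_eq_mul, Matrix.trace_mul_cycle,
    bmat_mul_self hg, add_mul, one_mul, Matrix.trace_add, smul_mul_assoc, Matrix.trace_smul,
    smul_eq_mul, fderiv_fderiv_apply]
  congr 3
  simp only [Matrix.trace, Matrix.diag, Matrix.mul_apply, Matrix.vecMulVec_apply]
  rw [Finset.sum_comm]
  exact Finset.sum_congr rfl fun i _ => Finset.sum_congr rfl fun j _ => by ring

lemma det_hess_le_det_amat {u : Euc n → ℝ} {x : Euc n} (hg : ‖gradient u x‖ < 1)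
    (hH : (Hess u x).PosSemidef) : (Hess u x).det ≤ (Amat u x).det := by
  have hw : 0 < 1 - ‖gradient u x‖ ^ 2 := by nlinarith [norm_nonneg (gradient u x)]
  have h1 : 1 ≤ (√(1 - ‖gradient u x‖ ^ 2))⁻¹ ^ n :=
    one_le_pow₀ ((one_le_inv₀ (Real.sqrt_pos.2 hw)).2
      (Real.sqrt_le_one.2 (by linarith [sq_nonneg ‖gradient u x‖])))
  have h2 := one_le_det_bmat (gradient u x)
  have h3 := hH.det_nonneg
  rw [Amat, Matrix.det_smul, Fintype.card_fin, Matrix.det_mul, Matrix.det_mul]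
  calc (Hess u x).det ≤ (√(1 - ‖gradient u x‖ ^ 2))⁻¹ ^ n *
        ((Bmat (gradient u x)).det * (Bmat (gradient u x)).det) * (Hess u x).det :=
        le_mul_of_one_le_left h3 (one_le_mul_of_one_le_of_one_le h1
          (one_le_mul_of_one_le_of_one_le h2 h2))
    _ = _ := by ring

lemma deriv_deriv_nonpos_of_isLocalMax {φ : ℝ → ℝ} {t : ℝ} (h : IsLocalMax φ t)
    (hc : ContinuousAt φ t) : deriv (deriv φ) t ≤ 0 := by
  by_contra! hpos
  have hmin := isLocalMin_of_deriv_deriv_pos hpos h.deriv_eq_zero hc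
  have heq : φ =ᶠ[𝓝 t] fun _ => φ t := by
    filter_upwards [h, hmin] with y h1 h2 using le_antisymm h1 h2
  have : deriv (deriv φ) t = 0 := by rw [heq.deriv.deriv_eq]; simp
  linarith

lemma hessian_le_of_isLocalMax_sub_sq {u : Euc n → ℝ} {x x₀ : Euc n} {s : ℝ}
    (hu : ContDiffAt ℝ 2 u x) (hmax : IsLocalMax (fun y => u y - s * ‖y - x₀‖ ^ 2) x)
    (ξ : Euc n) : fderiv ℝ (fderiv ℝ u) x ξ ξ ≤ 2 * s * ‖ξ‖ ^ 2 := by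
  let γ : ℝ → Euc n := fun t => x + t • ξ
  have hγ : ∀ t, HasDerivAt γ ξ t := fun t => by
    have := ((hasDerivAt_id t).smul_const ξ).const_add x
    rwa [one_smul] at this
  have hγ0 : γ 0 = x := by simp [γ]
  have hγc : Filter.Tendsto γ (𝓝 0) (𝓝 x) := by
    simpa [hγ0] using (hγ 0).continuousAt.tendsto
  have hud : ∀ᶠ y in 𝓝 x, DifferentiableAt ℝ u y :=
    (hu.eventually (by simp)).mono fun y hy => hy.differentiableAt (by norm_num)
  have hq : ∀ t, HasDerivAt (fun t => s * ‖γ t - x₀‖ ^ 2) (s * (2 * ⟪γ t - x₀, ξ⟫)) t := fun t =>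
    (((hγ t).sub_const x₀).norm_sq).const_mul s
  have hφ : ∀ᶠ t in 𝓝 (0 : ℝ), HasDerivAt (fun t => u (γ t) - s * ‖γ t - x₀‖ ^ 2)
      (fderiv ℝ u (γ t) ξ - s * (2 * ⟪γ t - x₀, ξ⟫)) t := by
    filter_upwards [hγc.eventually hud] with t ht
    exact (ht.hasFDerivAt.comp_hasDerivAt t (hγ t)).sub (hq t)
  have h1 : DifferentiableAt ℝ (fderiv ℝ u) (γ 0) := by
    rw [hγ0]
    exact (hu.fderiv_right (m := 1) (by norm_num)).differentiableAt (by norm_num)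
  have h2 : HasDerivAt (fun t => fderiv ℝ u (γ t) ξ - s * (2 * ⟪γ t - x₀, ξ⟫))
      (fderiv ℝ (fderiv ℝ u) (γ 0) ξ ξ - s * (2 * ⟪ξ, ξ⟫)) 0 := by
    have h3 := (h1.hasFDerivAt.comp_hasDerivAt 0 (hγ 0)).clm_apply (hasDerivAt_const 0 ξ)
    have h4 := (((hγ 0).sub_const x₀).inner ℝ (hasDerivAt_const 0 ξ)).const_mul 2 |>.const_mul s
    have h5 := h3.sub h4
    simp only [map_zero, inner_zero_right, zero_add, add_zero] at h5
    exact h5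
  have hmax' : IsLocalMax (fun t => u (γ t) - s * ‖γ t - x₀‖ ^ 2) 0 := by
    have := hγc.eventually hmax
    filter_upwards [this] with t ht
    simpa [hγ0] using ht
  have h5 := deriv_deriv_nonpos_of_isLocalMax hmax' hφ.self_of_nhds.continuousAt
  have h6 : deriv (fun t => u (γ t) - s * ‖γ t - x₀‖ ^ 2) =ᶠ[𝓝 0]
      fun t => fderiv ℝ u (γ t) ξ - s * (2 * ⟪γ t - x₀, ξ⟫) := hφ.mono fun t ht => ht.deriv
  rw [h6.deriv_eq, h2.deriv, hγ0, real_inner_self_eq_norm_sq] at h5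
  linarith

/-- A function with gradient less than one in norm on a ball of radius `R` touches from below, at
some point of the ball, a paraboloid of opening `2 / R`. -/
lemma exists_hessian_le {u : Euc n → ℝ} {x₀ : Euc n} {R : ℝ} (hR : 0 < R)
    (hu : ∀ y ∈ Metric.closedBall x₀ R, ContDiffAt ℝ 2 u y)
    (hg : ∀ y ∈ Metric.closedBall x₀ R, ‖gradient u y‖ < 1) :
    ∃ y ∈ Metric.closedBall x₀ R, ∀ ξ, fderiv ℝ (fderiv ℝ u) y ξ ξ ≤ 2 * (2 / R) * ‖ξ‖ ^ 2 := by
  have hx₀ : x₀ ∈ Metric.closedBall x₀ R := Metric.mem_closedBall_self hR.le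
  have hc : ContinuousOn (fun y => u y - 2 / R * ‖y - x₀‖ ^ 2) (Metric.closedBall x₀ R) :=
    ContinuousOn.sub (fun y hy => (hu y hy).continuousAt.continuousWithinAt) (by fun_prop)
  obtain ⟨y, hy, hmax⟩ := (isCompact_closedBall x₀ R).exists_isMaxOn ⟨x₀, hx₀⟩ hc
  have hlip : ‖u y - u x₀‖ ≤ 1 * ‖y - x₀‖ :=
    (convex_closedBall x₀ R).norm_image_sub_le_of_norm_fderiv_le
      (fun z hz => (hu z hz).differentiableAt (by norm_num))
      (fun z hz => by
        rw [← toDual_gradient, LinearIsometryEquiv.norm_map]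
        exact (hg z hz).le) hx₀ hy
  have hle : u x₀ - 2 / R * ‖x₀ - x₀‖ ^ 2 ≤ u y - 2 / R * ‖y - x₀‖ ^ 2 := hmax hx₀
  have hlt : ‖y - x₀‖ < R := by
    by_contra! hge
    rw [sub_self, norm_zero] at hle
    have h1 := (le_abs_self _).trans hlip
    have h2 : 2 * ‖y - x₀‖ ≤ 2 / R * ‖y - x₀‖ ^ 2 := by
      rw [div_mul_eq_mul_div, le_div_iff₀ hR]
      nlinarith [norm_nonneg (y - x₀)]
    linarith
  refine ⟨y, hy, fun ξ => hessian_le_of_isLocalMax_sub_sq (x₀ := x₀) (hu y hy) ?_ ξ⟩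
  exact hmax.isLocalMax (Filter.mem_of_superset
    (Metric.isOpen_ball.mem_nhds (by simpa [dist_eq_norm] using hlt)) Metric.ball_subset_closedBall)

/-- If the Hessian determinant is at most `m` on `Ω`, then `|∇u(Ω)| ≤ m |Ω|`. -/
lemma volume_image_gradient_le {Ω : Set (Euc n)} {u : Euc n → ℝ} {m : ℝ} (hΩ : IsOpen Ω)
    (hu : ∀ y ∈ Ω, ContDiffAt ℝ 2 u y) (hH : ∀ y ∈ Ω, (Hess u y).PosSemidef)
    (hm : ∀ y ∈ Ω, (Hess u y).det ≤ m) :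
    volume (gradient u '' Ω) ≤ ENNReal.ofReal m * volume Ω := by
  refine (addHaar_image_le_lintegral_abs_det_fderiv volume hΩ.measurableSet
    fun y hy => (differentiableAt_gradient (hu y hy)).hasFDerivAt.hasFDerivWithinAt).trans ?_
  refine (setLIntegral_mono' hΩ.measurableSet fun y hy => ?_).trans_eq (setLIntegral_const Ω _)
  rw [det_fderiv_gradient (hu y hy), abs_of_nonneg (hH y hy).det_nonneg]
  exact ENNReal.ofReal_le_ofReal (hm y hy)

/-- Mean curvature at most `m` everywhere forces `|∇u(Ω)| ≤ (m / n) ^ n |Ω|`. -/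
lemma volume_image_gradient_le_of_minkDiv_le (hn : n ≠ 0) {Ω : Set (Euc n)} {u : Euc n → ℝ} {m : ℝ}
    (hΩ : IsOpen Ω) (hu : ∀ y ∈ Ω, ContDiffAt ℝ 2 u y) (hH : ∀ y ∈ Ω, (Hess u y).PosSemidef)
    (hg : ∀ y ∈ Ω, ‖gradient u y‖ < 1) (hm : ∀ y ∈ Ω, MinkDiv u y ≤ m) :
    volume (gradient u '' Ω) ≤ ENNReal.ofReal ((m / n) ^ n) * volume Ω := by
  refine volume_image_gradient_le hΩ hu hH fun y hy => ?_
  have hA := amat_posSemidef (hH y hy)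
  refine (det_hess_le_det_amat (hg y hy) (hH y hy)).trans ((det_le_trace_div_pow hn hA).trans ?_)
  have h0 := hA.trace_nonneg
  have h1 := hm y hy
  rw [← trace_amat (hu y hy) (hg y hy)] at h1
  gcongr

/-- An upper Hessian bound and a gradient bound give an upper mean-curvature bound. -/
lemma minkDiv_le {u : Euc n → ℝ} {x : Euc n} {r K : ℝ} (hu : ContDiffAt ℝ 2 u x) (hr : r < 1)
    (hg : ‖gradient u x‖ ≤ r) (hK : 0 ≤ K)
    (hH : ∀ ξ, fderiv ℝ (fderiv ℝ u) x ξ ξ ≤ K * ‖ξ‖ ^ 2) :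
    MinkDiv u x ≤ (√(1 - r ^ 2))⁻¹ * (n * K + (1 - r ^ 2)⁻¹ * K) := by
  have h0 := norm_nonneg (gradient u x)
  have hr0 : 0 < 1 - r ^ 2 := by nlinarith
  have hrg : 1 - r ^ 2 ≤ 1 - ‖gradient u x‖ ^ 2 := by nlinarith
  have hw : 0 < 1 - ‖gradient u x‖ ^ 2 := hr0.trans_le hrg
  have htr : (Hess u x).trace ≤ n * K := by
    calc (Hess u x).trace ≤ ∑ _i : Fin n, K := Finset.sum_le_sum fun i _ => by
          simpa [hess_apply] using hH (EuclideanSpace.single i 1)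
      _ = n * K := by simp
  have hq : fderiv ℝ (fderiv ℝ u) x (gradient u x) (gradient u x) ≤ K :=
    (hH _).trans (mul_le_of_le_one_right hK (by nlinarith))
  have hvr : 0 < √(1 - r ^ 2) := Real.sqrt_pos.2 hr0
  rw [minkDiv_eq hu (hg.trans_lt hr)]
  calc _ ≤ (√(1 - ‖gradient u x‖ ^ 2))⁻¹ * (n * K + (1 - ‖gradient u x‖ ^ 2)⁻¹ * K) := by gcongr
    _ ≤ _ := by gcongr

theorem statement_4 {n : ℕ} (hn : 2 ≤ n)
    (Ω Ωt : Set (Euc n)) (ht h : Euc n → ℝ) (θt θ : ℝ)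
    (hdom : DomainSetup Ω Ωt ht h θt θ)
    (hball : closure Ωt ⊆ Metric.ball (0 : Euc n) 1)
    (f : Euc n × Euc n → ℝ)
    (hf : ContDiffOn ℝ 2 f (closure Ω ×ˢ closure Ωt))
    (hosc : OSCcond Ω Ωt f) :
    ∃ Λ₃ Λ₄ : ℝ, 0 < Λ₃ ∧ 0 < Λ₄ ∧
      ∀ (c : ℝ) (u : Euc n → ℝ), IsStrictSol Ω Ωt f c u → ∀ x ∈ Ω,
        Λ₃ ≤ (Amat u x ^ 2).trace ∧ (Amat u x ^ 2).trace ≤ Λ₄ := by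
  obtain ⟨hΩ, hΩt, hΩb, hΩtb, ⟨x₀, hx₀⟩, hΩtne, -⟩ := hdom
  have hn0 : n ≠ 0 := by omega
  have hnpos : (0 : ℝ) < n := by positivity
  have hV : 0 < (volume Ω).toReal :=
    ENNReal.toReal_pos (hΩ.measure_pos volume ⟨x₀, hx₀⟩).ne' hΩb.measure_lt_top.ne
  have hVt : 0 < (volume Ωt).toReal :=
    ENNReal.toReal_pos (hΩt.measure_pos volume hΩtne).ne' hΩtb.measure_lt_top.ne
  set q : ℝ := ((volume Ωt).toReal / (volume Ω).toReal) ^ ((1 : ℝ) / n) with hq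
  have hq0 : 0 < q := Real.rpow_pos_of_pos (div_pos hVt hV) _
  have hqn : q ^ n = (volume Ωt).toReal / (volume Ω).toReal := by
    rw [hq, one_div]
    exact Real.rpow_inv_natCast_pow (div_pos hVt hV).le hn0
  obtain ⟨R, hR, hRΩ⟩ := Metric.nhds_basis_closedBall.mem_iff.1 (hΩ.mem_nhds hx₀)
  obtain ⟨r, hr0, hr1, hr⟩ : ∃ r : ℝ, 0 ≤ r ∧ r < 1 ∧ ∀ p ∈ Ωt, ‖p‖ ≤ r := by
    obtain ⟨p, hp, hmax⟩ := hΩtb.isCompact_closure.exists_isMaxOn hΩtne.closure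
      continuous_norm.continuousOn
    exact ⟨‖p‖, norm_nonneg p, by simpa using hball hp, fun y hy => hmax (subset_closure hy)⟩
  set C : ℝ := (√(1 - r ^ 2))⁻¹ * (n * (2 * (2 / R)) + (1 - r ^ 2)⁻¹ * (2 * (2 / R))) with hC
  have hC0 : 0 ≤ C := by
    have : 0 < 1 - r ^ 2 := by nlinarith
    positivity
  refine ⟨(n / 2 * q) ^ 2 / n, (C + n / 2 * q) ^ 2, by positivity, by positivity, ?_⟩
  rintro c u ⟨hu, hH, hg, heq, him⟩ x hx
  have hu' : ∀ y ∈ Ω, ContDiffAt ℝ 2 u y := fun y hy =>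
    hu.contDiffAt (Filter.mem_of_superset (hΩ.mem_nhds hy) subset_closure)
  have hH' : ∀ y ∈ Ω, (Hess u y).PosSemidef := fun y hy => (hH y (subset_closure hy)).posSemidef
  have hg' : ∀ y ∈ Ω, ‖gradient u y‖ < 1 := fun y hy => hg y (subset_closure hy)
  have hgt : ∀ y ∈ Ω, gradient u y ∈ Ωt := fun y hy => him ▸ mem_image_of_mem _ hy
  have hoscH : ∀ y ∈ Ω, ∀ z ∈ Ω, MinkDiv u y ≤ MinkDiv u z + n / 2 * q := by
    intro y hy z hz
    have := hosc y (subset_closure hy) z (subset_closure hz) _ (subset_closure (hgt y hy))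
      _ (subset_closure (hgt z hz))
    rw [heq y hy, heq z hz]
    linarith [(le_abs_self _).trans this]
  have hlow : n / 2 * q ≤ MinkDiv u x := by
    by_contra! hlt
    have hvol := volume_image_gradient_le_of_minkDiv_le hn0 hΩ hu' hH' hg'
      fun y hy => hoscH y hy x hx
    have h0 : 0 ≤ MinkDiv u x := by
      rw [← trace_amat (hu' x hx) (hg' x hx)]
      exact (amat_posSemidef (hH' x hx)).trace_nonneg
    have hm : ((MinkDiv u x + n / 2 * q) / n) ^ n < q ^ n := by
      refine pow_lt_pow_left₀ ?_ (by positivity) hn0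
      rw [div_lt_iff₀ hnpos]
      linarith
    have hvol' := ENNReal.toReal_mono
      (ENNReal.mul_ne_top ENNReal.ofReal_ne_top hΩb.measure_lt_top.ne) hvol
    rw [him, ENNReal.toReal_mul, ENNReal.toReal_ofReal (by positivity)] at hvol'
    rw [hqn, lt_div_iff₀ hV] at hm
    linarith
  have hupp : MinkDiv u x ≤ C + n / 2 * q := by
    obtain ⟨y, hy, hyH⟩ := exists_hessian_le hR (fun y hy => hu' y (hRΩ hy))
      (fun y hy => hg' y (hRΩ hy))
    have h1 := minkDiv_le (hu' y (hRΩ hy)) hr1 (hr _ (hgt y (hRΩ hy))) (by positivity) hyH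
    linarith [hoscH x hx y (hRΩ hy)]
  have hA := amat_posSemidef (hH' x hx)
  have h1 := sq_trace_le hA.isHermitian
  have h2 := trace_sq_le hA
  rw [trace_amat (hu' x hx) (hg' x hx)] at h1 h2
  have hpos : 0 < n / 2 * q := by positivity
  have hpos' := hpos.trans_le hlow
  refine ⟨?_, h2.trans (by gcongr)⟩
  rw [div_le_iff₀ hnpos]
  calc (n / 2 * q) ^ 2 ≤ MinkDiv u x ^ 2 := by gcongr
    _ ≤ _ := by linarith

end
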